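/- arXiv:1702.03068 — 5 statements merged into one kernel-verified Lean document; each statement's English description precedes it below -/
import Mathlib

section
/- Let n, t be natural numbers with n > 3t. Let P be a finite type with Fintype.card P = n and let F be a finset of P with F.card ≤ t. Let g₁, g₂ : P → Bool be functions such that g₁ p = g₂ p for every p ∉ F. Suppose Q₁ and Q₂ are finsets of P with Q₁.card ≥ n − t and Q₂.card ≥ n − t, and binary values v, w : Bool satisfy g₁ q = v for all q ∈ Q₁ and g₂ q = w for all q ∈ Q₂. Then v = w. -/
theorem unanimous_quorums_same_value
    (n t : ℕ) (hn : n > 3 * t)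
    (P : Type*) [Fintype P] [DecidableEq P]
    (hcard : Fintype.card P = n)
    (F : Finset P) (hF : F.card ≤ t)
    (g₁ g₂ : P → Bool) (hg : ∀ p, p ∉ F → g₁ p = g₂ p)
    (Q₁ Q₂ : Finset P) (hQ₁ : Q₁.card ≥ n - t) (hQ₂ : Q₂.card ≥ n - t)
    (v w : Bool)
    (hv : ∀ q ∈ Q₁, g₁ q = v) (hw : ∀ q ∈ Q₂, g₂ q = w) :
    v = w := by
  have hlt : F.card < (Q₁ ∩ Q₂).card := by
    have hinter := Finset.card_union_add_card_inter Q₁ Q₂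
    have hunion := Finset.card_le_univ (Q₁ ∪ Q₂)
    omega
  obtain ⟨p, hp, hpF⟩ := Finset.exists_mem_notMem_of_card_lt_card hlt
  obtain ⟨hp₁, hp₂⟩ := Finset.mem_inter.mp hp
  rw [← hv p hp₁, ← hw p hp₂, hg p hpF]
end

section
/- Let n, t be natural numbers with n > 3t. Let P be a finite type with Fintype.card P = n and let F be a finset of P with F.card ≤ t. Let V be a type with a value v : V, and let g₁, g₂ : P → Finset V be functions such that g₁ p = g₂ p for every p ∉ F. Suppose Q₁ is a finset of P with Q₁.card ≥ n − t and g₁ q = {v} for all q ∈ Q₁, and Q₂ is a finset of P with Q₂.card ≥ n − t. Then there exists a process q ∈ Q₂ with q ∉ F and g₂ q = {v}; in particular v belongs to the union ⋃_{q ∈ Q₂} g₂ q. -/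
theorem singleton_quorum_value_in_other_quorum
    (n t : ℕ) (hn : n > 3 * t)
    (P : Type*) [Fintype P] [DecidableEq P]
    (hcard : Fintype.card P = n)
    (F : Finset P) (hF : F.card ≤ t)
    (V : Type*) [DecidableEq V] (v : V)
    (g₁ g₂ : P → Finset V) (hg : ∀ p, p ∉ F → g₁ p = g₂ p)
    (Q₁ : Finset P) (hQ₁ : Q₁.card ≥ n - t) (hv : ∀ q ∈ Q₁, g₁ q = {v})
    (Q₂ : Finset P) (hQ₂ : Q₂.card ≥ n - t) :
    (∃ q ∈ Q₂, q ∉ F ∧ g₂ q = {v}) ∧ v ∈ Q₂.biUnion g₂ := by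
  have hinter : F.card < (Q₁ ∩ Q₂).card := by
    have h₁ := Finset.card_union_add_card_inter Q₁ Q₂
    have h₂ := Finset.card_le_univ (Q₁ ∪ Q₂)
    omega
  obtain ⟨q, hq, hqF⟩ := Finset.exists_mem_notMem_of_card_lt_card hinter
  obtain ⟨hq₁, hq₂⟩ := Finset.mem_inter.mp hq
  have hgq : g₂ q = {v} := (hg q hqF).symm.trans (hv q hq₁)
  exact ⟨⟨q, hq₂, hqF, hgq⟩, Finset.mem_biUnion.mpr ⟨q, hq₂, by simp [hgq]⟩⟩
end

section
/- Let t be a natural number, P a finite type, and F a finset of P with F.card ≤ t. Let B and prop be finsets of P and τ : P → ℕ a function. Assume that for every p ∈ B with p ∉ F and p ∉ prop there exists a finset Q ⊆ B with Q.card ≥ t + 1 such that every q ∈ Q with q ∉ F satisfies τ q < τ p. If B \ F is nonempty, then there exists a process p ∈ B ∩ prop with p ∉ F. -/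
theorem bv_justification_broadcaster
    (t : ℕ)
    (P : Type*) [Fintype P] [DecidableEq P]
    (F : Finset P) (hF : F.card ≤ t)
    (B prop : Finset P) (τ : P → ℕ)
    (hecho : ∀ p ∈ B, p ∉ F → p ∉ prop →
      ∃ Q : Finset P, Q ⊆ B ∧ Q.card ≥ t + 1 ∧
        ∀ q ∈ Q, q ∉ F → τ q < τ p)
    (hne : (B \ F).Nonempty) :
    ∃ p ∈ B ∩ prop, p ∉ F := by
  obtain ⟨p, hp, hmin⟩ := Finset.exists_min_image (B \ F) τ hne
  obtain ⟨hpB, hpF⟩ := Finset.mem_sdiff.mp hp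
  by_cases hprop : p ∈ prop
  · exact ⟨p, Finset.mem_inter.mpr ⟨hpB, hprop⟩, hpF⟩
  · obtain ⟨Q, hQB, hQcard, hQτ⟩ := hecho p hpB hpF hprop
    obtain ⟨q, hqQ, hqF⟩ := Finset.exists_mem_notMem_of_card_lt_card
      (show F.card < Q.card by omega)
    have hle : τ p ≤ τ q := hmin q (Finset.mem_sdiff.mpr ⟨hQB hqQ, hqF⟩)
    exact absurd (hQτ q hqQ hqF) hle.not_gt
end

section
/- Let t be a natural number, P a finite type, and F a finset of P with F.card ≤ t. Let B and prop be finsets of P and τ : P → ℕ a function. Assume: (i) for every p ∈ B with p ∉ F and p ∉ prop there exists a finset Q ⊆ B with Q.card ≥ t + 1 such that every q ∈ Q with q ∉ F satisfies τ q < τ p; and (ii) there exists a finset R of P with R.card ≥ 2t + 1 and R \ F ⊆ B. Then there exists a process p ∈ prop with p ∉ F. -/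
theorem bv_justification
    (t : ℕ)
    (P : Type*) [Fintype P] [DecidableEq P]
    (F : Finset P) (hF : F.card ≤ t)
    (B prop : Finset P) (τ : P → ℕ)
    (hecho : ∀ p ∈ B, p ∉ F → p ∉ prop →
      ∃ Q : Finset P, Q ⊆ B ∧ Q.card ≥ t + 1 ∧
        ∀ q ∈ Q, q ∉ F → τ q < τ p)
    (hdeliver : ∃ R : Finset P, R.card ≥ 2 * t + 1 ∧ R \ F ⊆ B) :
    ∃ p ∈ prop, p ∉ F := by
  obtain ⟨R, hR, hRB⟩ := hdeliver
  obtain ⟨r, hrR, hrF⟩ := Finset.exists_mem_notMem_of_card_lt_card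
    (show F.card < R.card by omega)
  have hr : r ∈ B \ F :=
    Finset.mem_sdiff.2 ⟨hRB (Finset.mem_sdiff.2 ⟨hrR, hrF⟩), hrF⟩
  obtain ⟨p, hp, hmin⟩ := Finset.exists_min_image (B \ F) τ ⟨r, hr⟩
  obtain ⟨hpB, hpF⟩ := Finset.mem_sdiff.1 hp
  by_contra hprop
  obtain ⟨Q, hQB, hQ, hlt⟩ := hecho p hpB hpF fun h => hprop ⟨p, h, hpF⟩
  obtain ⟨q, hqQ, hqF⟩ := Finset.exists_mem_notMem_of_card_lt_card
    (show F.card < Q.card by omega)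
  exact (hlt q hqQ hqF).not_ge (hmin q (Finset.mem_sdiff.2 ⟨hQB hqQ, hqF⟩))
end

section
/- Let n, t be natural numbers with n > 3t. Let P be a finite type with Fintype.card P = n and let F be a finset of P with F.card ≤ t. Let B be a finset of P such that: (i) if B.card ≥ t + 1 then every p ∉ F satisfies p ∈ B (the echo-closure property); and (ii) there exists a finset R of P with R.card ≥ 2t + 1 and R \ F ⊆ B. Then (B \ F).card ≥ 2t + 1. -/
theorem bv_uniformity_counting
    (n t : ℕ) (hn : n > 3 * t)
    (P : Type*) [Fintype P] [DecidableEq P]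
    (hcard : Fintype.card P = n)
    (F : Finset P) (hF : F.card ≤ t)
    (B : Finset P)
    (hecho : B.card ≥ t + 1 → ∀ p, p ∉ F → p ∈ B)
    (hdeliver : ∃ R : Finset P, R.card ≥ 2 * t + 1 ∧ R \ F ⊆ B) :
    (B \ F).card ≥ 2 * t + 1 := by
  obtain ⟨R, hR, hRB⟩ := hdeliver
  have hB : t + 1 ≤ B.card := by
    have hle := Finset.card_le_card hRB
    have hsub := Finset.le_card_sdiff F R
    omega
  have hcompl : Fᶜ ⊆ B \ F := fun p hp => by
    have hpF : p ∉ F := Finset.mem_compl.mp hp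
    exact Finset.mem_sdiff.mpr ⟨hecho hB p hpF, hpF⟩
  have hle := Finset.card_le_card hcompl
  rw [Finset.card_compl, hcard] at hle
  omega
end
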